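/- arXiv:2009.10918 — 6 statements merged into one kernel-verified Lean document; each statement's English description precedes it below -/
import Mathlib

section
/- Let N ≥ 2 be a natural number, m a natural number, and r a natural number with gcd(r, N) = 1. Then in ZMod (N^2), the ciphertext c = (1+N)^m · r^N satisfies c^(φ(N)) = 1 + (m · φ(N)) · N, where φ is Euler's totient function. In particular, raising a ciphertext to the totient exponent removes the randomness and exposes the plaintext m·φ(N) in the linear coefficient of N. -/
theorem one_add_pow_of_sq_zero {R : Type*} [CommRing R] (a : R) (ha : a * a = 0) (n : ℕ) :
    (1 + a) ^ n = 1 + n * a := by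
  induction n with
  | zero => simp
  | succ k ih =>
    rw [pow_succ, ih]
    push_cast
    linear_combination (k : R) * ha

/-- Decryption correctness: for N ≥ 2, gcd(r, N) = 1, the ciphertext
c = (1+N)^m · r^N in ZMod (N^2) satisfies c^(φ(N)) = 1 + (m·φ(N))·N. -/
theorem paillier_dec_correct (N m r : ℕ) (hN : 2 ≤ N) (hr : Nat.gcd r N = 1) :
    (((1 + (N : ZMod (N ^ 2))) ^ m * (r : ZMod (N ^ 2)) ^ N) ^ Nat.totient N
      = 1 + ((m * Nat.totient N : ℕ) : ZMod (N ^ 2)) * N) := by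
  have h0 : (N : ZMod (N ^ 2)) * N = 0 := by
    have := ZMod.natCast_self (N ^ 2)
    push_cast at this
    rw [← this]; ring
  have h1 : (r ^ Nat.totient N) ≡ 1 [MOD N] := Nat.ModEq.pow_totient hr
  obtain ⟨k, hk⟩ := h1.symm.dvd
  have h2 : (r : ZMod (N ^ 2)) ^ Nat.totient N = 1 + N * (k : ZMod (N ^ 2)) := by
    have := congrArg (Int.cast : ℤ → ZMod (N ^ 2)) hk
    push_cast at this
    linear_combination this
  have h3 : ((r : ZMod (N ^ 2)) ^ N) ^ Nat.totient N = 1 := by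
    rw [← pow_mul, mul_comm, pow_mul, h2, one_add_pow_of_sq_zero]
    · linear_combination (k : ZMod (N ^ 2)) * h0
    · linear_combination (k : ZMod (N ^ 2)) ^ 2 * h0
  rw [mul_pow, h3, mul_one, ← pow_mul, one_add_pow_of_sq_zero _ h0]
end

section
/- Let N ≥ 2 be a natural number with gcd(N, φ(N)) = 1, where φ is Euler's totient function. Let m₁, m₂, r₁, r₂ be natural numbers with gcd(r₁, N) = 1 and gcd(r₂, N) = 1. If (1+N)^(m₁) · r₁^N = (1+N)^(m₂) · r₂^N in ZMod (N^2), then m₁ ≡ m₂ (mod N). -/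
theorem paillier_aux_pow (N k : ℕ) :
    (1 + (N : ZMod (N ^ 2))) ^ k = 1 + (k : ZMod (N ^ 2)) * N := by
  have h0 : (N : ZMod (N ^ 2)) ^ 2 = 0 := by
    have := ZMod.natCast_self (N ^ 2)
    push_cast at this
    exact this
  induction k with
  | zero => simp
  | succ k ih =>
    rw [pow_succ _ k, ih]
    push_cast
    linear_combination (k : ZMod (N ^ 2)) * h0

theorem paillier_aux_unit (N r : ℕ) (hN : 2 ≤ N) (hr : Nat.gcd r N = 1) :
    ((r : ZMod (N ^ 2)) ^ N) ^ Nat.totient N = 1 := by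
  have ht : Nat.totient (N ^ 2) = N * Nat.totient N := by
    have h := Nat.totient_gcd_mul_totient_mul N N
    have hp : 0 < Nat.totient N := Nat.totient_pos.2 (by omega)
    rw [Nat.gcd_self] at h
    rw [pow_two]
    apply Nat.eq_of_mul_eq_mul_left hp
    rw [h]; ring
  have h := Nat.ModEq.pow_totient (x := r) (n := N ^ 2) (Nat.Coprime.pow_right 2 hr)
  rw [← ZMod.natCast_eq_natCast_iff, ht] at h
  push_cast at h
  rw [← pow_mul, h]

/-- Soundness of decryption: if two Paillier ciphertexts coincide in ZMod (N^2)
then the plaintexts agree modulo N. -/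
theorem paillier_dec_sound (N m₁ m₂ r₁ r₂ : ℕ) (hN : 2 ≤ N)
    (hcop : Nat.gcd N (Nat.totient N) = 1)
    (hr₁ : Nat.gcd r₁ N = 1) (hr₂ : Nat.gcd r₂ N = 1)
    (h : (1 + (N : ZMod (N ^ 2))) ^ m₁ * (r₁ : ZMod (N ^ 2)) ^ N
        = (1 + (N : ZMod (N ^ 2))) ^ m₂ * (r₂ : ZMod (N ^ 2)) ^ N) :
    m₁ ≡ m₂ [MOD N] := by
  have h2 := congrArg (fun x => x ^ Nat.totient N) h
  simp only [mul_pow] at h2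
  rw [paillier_aux_unit N r₁ hN hr₁, paillier_aux_unit N r₂ hN hr₂, mul_one, mul_one,
    ← pow_mul, ← pow_mul, paillier_aux_pow, paillier_aux_pow] at h2
  have h3 := add_left_cancel h2
  have h4 : m₁ * Nat.totient N * N ≡ m₂ * Nat.totient N * N [MOD N * N] := by
    rw [← pow_two, ← ZMod.natCast_eq_natCast_iff]
    exact_mod_cast h3
  have h5 := Nat.ModEq.mul_right_cancel' (by omega : N ≠ 0) h4
  exact Nat.ModEq.cancel_right_of_coprime hcop h5
end

section
/- Let N ≥ 2 be a natural number, m a natural number, and r a natural number with gcd(r, N) = 1. Then in ZMod (N^2) there exists a natural number s with gcd(s, N) = 1 such that ((1+N)^m · r^N)^(N-1) = (1+N)^((N - m mod N) mod N) · s^N. That is, raising a Paillier ciphertext of m to the power N−1 yields a Paillier ciphertext of (−m) mod N. -/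
/-- Homomorphic negation: raising a Paillier ciphertext of m to the power N−1
yields a Paillier ciphertext of (−m) mod N. -/
theorem paillier_neg_homomorphic (N m r : ℕ) (hN : 2 ≤ N)
    (hr : Nat.gcd r N = 1) :
    ∃ s : ℕ, Nat.gcd s N = 1 ∧
      ((1 + (N : ZMod (N ^ 2))) ^ m * (r : ZMod (N ^ 2)) ^ N) ^ (N - 1)
      = (1 + (N : ZMod (N ^ 2))) ^ ((N - m % N) % N) * (s : ZMod (N ^ 2)) ^ N := by
  have hsq : (N : ZMod (N ^ 2)) * N = 0 := by
    have h := ZMod.natCast_self (N ^ 2)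
    rw [Nat.cast_pow] at h
    exact (pow_two (N : ZMod (N ^ 2))).symm.trans h
  have hk : ∀ k : ℕ, (1 + (N : ZMod (N ^ 2))) ^ k = 1 + k * N := by
    intro k
    induction k with
    | zero => simp
    | succ k ih =>
      rw [pow_succ (1 + (N : ZMod (N ^ 2))) k, ih]
      push_cast
      linear_combination (k : ZMod (N ^ 2)) * hsq
  have h1 : (1 + (N : ZMod (N ^ 2))) ^ N = 1 := by
    rw [hk, hsq, add_zero]
  have hmod : m * (N - 1) ≡ (N - m % N) % N [MOD N] := by
    rw [← ZMod.natCast_eq_natCast_iff]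
    have hle : m % N ≤ N := (Nat.mod_lt _ (by omega)).le
    rw [ZMod.natCast_mod, Nat.cast_mul, Nat.cast_sub hle, Nat.cast_sub (by omega : 1 ≤ N),
      ZMod.natCast_mod, ZMod.natCast_self]
    push_cast
    ring
  refine ⟨r ^ (N - 1), Nat.Coprime.pow_left _ hr, ?_⟩
  have h2 : (1 + (N : ZMod (N ^ 2))) ^ (m * (N - 1))
      = (1 + (N : ZMod (N ^ 2))) ^ ((N - m % N) % N) := by
    rw [pow_eq_pow_mod (m * (N - 1)) h1, hmod, ← pow_eq_pow_mod _ h1]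
  rw [mul_pow, ← pow_mul, h2, Nat.cast_pow, ← pow_mul, ← pow_mul, mul_comm N (N - 1)]
end

section
/- Let N ≥ 2 be a natural number, let y and ŷ be natural numbers, and let r₁, r₂ be natural numbers with gcd(r₁, N) = 1 and gcd(r₂, N) = 1. Then in ZMod (N^2) there exists a natural number s with gcd(s, N) = 1 such that ((1+N)^y · r₁^N) · ((1+N)^(ŷ) · r₂^N)^(N-1) = (1+N)^((y + (N - ŷ mod N)) mod N) · s^N. In particular, this product is a Paillier ciphertext of (y − ŷ) mod N; squaring that plaintext gives the per-sample mean squared error (y − ŷ)². -/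
theorem paillier_residual_aux (N : ℕ) : (1 + (N : ZMod (N ^ 2))) ^ N = 1 := by
  have h0 : (N : ZMod (N ^ 2)) * (N : ZMod (N ^ 2)) = 0 := by
    have h := ZMod.natCast_self (N ^ 2)
    push_cast at h
    rw [← h]; ring
  have h : ∀ k : ℕ, (1 + (N : ZMod (N ^ 2))) ^ k = 1 + k * (N : ZMod (N ^ 2)) := by
    intro k
    induction k with
    | zero => simp
    | succ k ih =>
      rw [pow_succ (1 + (N : ZMod (N ^ 2))) k, ih]
      push_cast
      linear_combination (k : ZMod (N ^ 2)) * h0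
  rw [h, h0, add_zero]

/-- SecureMSE residual: [[y]] · [[ŷ]]^(N−1) is a Paillier ciphertext of
(y + (N − ŷ mod N)) mod N, i.e. of (y − ŷ) mod N. -/
theorem paillier_residual (N y yhat r₁ r₂ : ℕ) (hN : 2 ≤ N)
    (hr₁ : Nat.gcd r₁ N = 1) (hr₂ : Nat.gcd r₂ N = 1) :
    ∃ s : ℕ, Nat.gcd s N = 1 ∧
      ((1 + (N : ZMod (N ^ 2))) ^ y * (r₁ : ZMod (N ^ 2)) ^ N)
        * (((1 + (N : ZMod (N ^ 2))) ^ yhat * (r₂ : ZMod (N ^ 2)) ^ N)) ^ (N - 1)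
      = (1 + (N : ZMod (N ^ 2))) ^ ((y + (N - yhat % N)) % N) * (s : ZMod (N ^ 2)) ^ N := by
  refine ⟨r₁ * r₂ ^ (N - 1), Nat.Coprime.mul_left hr₁ (Nat.Coprime.pow_left _ hr₂), ?_⟩
  have hmod : (y + yhat * (N - 1)) % N = (y + (N - yhat % N)) % N := by
    have hlt : yhat % N < N := Nat.mod_lt _ (by omega)
    change (y + yhat * (N - 1)) ≡ (y + (N - yhat % N)) [MOD N]
    rw [← Int.natCast_modEq_iff]
    apply Int.ModEq.symm
    rw [Int.modEq_iff_dvd]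
    have hd : (yhat : ℤ) = N * (yhat / N : ℕ) + (yhat % N : ℕ) := by
      exact_mod_cast (Nat.div_add_mod yhat N).symm
    push_cast [Nat.cast_sub hlt.le, Nat.cast_sub (show 1 ≤ N by omega)] at hd ⊢
    refine ⟨yhat - 1 - (yhat : ℤ) / N, ?_⟩
    linear_combination -hd
  have hp := pow_eq_pow_mod (y + yhat * (N - 1)) (paillier_residual_aux N)
  rw [← hmod, ← hp]
  push_cast
  rw [pow_add, pow_mul, mul_pow, mul_pow, ← pow_mul (r₂ : ZMod (N ^ 2)) N,
    ← pow_mul (r₂ : ZMod (N ^ 2)) (N - 1), mul_comm N (N - 1)]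
  ring
end

section
/- Let N ≥ 2 be a natural number, let w and r be natural numbers with w < N, set w' = (w + r) mod N, and let r₁, r₂ be natural numbers with gcd(r₁, N) = 1 and gcd(r₂, N) = 1. Then in ZMod (N^2) there exists a natural number s with gcd(s, N) = 1 such that ((1+N)^(w') · r₁^N) · ((1+N)^r · r₂^N)^(N-1) = (1+N)^w · s^N. That is, re-encrypting the blinded plaintext w' = w + r mod N and homomorphically multiplying by the (N−1)-th power of a ciphertext of the blinding value r yields a valid Paillier ciphertext of the original weight w. -/
/-- Correctness of unblinding in SecureAggregation: re-encrypting the blinded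
weight w' = (w + r) mod N and multiplying by [[r]]^(N−1) yields a valid
ciphertext of the original weight w. -/
theorem paillier_unblind (N w r r₁ r₂ : ℕ) (hN : 2 ≤ N) (hw : w < N)
    (hr₁ : Nat.gcd r₁ N = 1) (hr₂ : Nat.gcd r₂ N = 1) :
    ∃ s : ℕ, Nat.gcd s N = 1 ∧
      ((1 + (N : ZMod (N ^ 2))) ^ ((w + r) % N) * (r₁ : ZMod (N ^ 2)) ^ N)
        * (((1 + (N : ZMod (N ^ 2))) ^ r * (r₂ : ZMod (N ^ 2)) ^ N)) ^ (N - 1)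
      = (1 + (N : ZMod (N ^ 2))) ^ w * (s : ZMod (N ^ 2)) ^ N := by
  have hNN : (N : ZMod (N ^ 2)) * N = 0 := by
    have h := ZMod.natCast_self (N ^ 2)
    rw [← h]; push_cast; ring
  have hk : ∀ k : ℕ, (1 + (N : ZMod (N ^ 2))) ^ k = 1 + k * N := by
    intro k
    induction k with
    | zero => simp
    | succ k ih =>
      rw [pow_succ (1 + (N : ZMod (N ^ 2))) k, ih]; push_cast
      linear_combination (k : ZMod (N ^ 2)) * hNN
  have hg : (1 + (N : ZMod (N ^ 2))) ^ N = 1 := by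
    rw [hk, hNN, add_zero]
  have hexp : ((w + r) % N + r * (N - 1)) % N = w := by
    obtain ⟨M, rfl⟩ : ∃ M, N = M + 1 := ⟨N - 1, by omega⟩
    rw [Nat.mod_add_mod, Nat.add_sub_cancel,
      show w + r + r * M = w + (M + 1) * r by ring, Nat.add_mul_mod_self_left,
      Nat.mod_eq_of_lt hw]
  refine ⟨r₁ * r₂ ^ (N - 1), ?_, ?_⟩
  · exact Nat.Coprime.mul_left hr₁ (Nat.Coprime.pow_left _ hr₂)
  · have h1 : (1 + (N : ZMod (N ^ 2))) ^ ((w + r) % N + r * (N - 1))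
        = (1 + (N : ZMod (N ^ 2))) ^ w := by
      rw [pow_eq_pow_mod _ hg, hexp]
    rw [← h1]
    push_cast
    rw [mul_pow, mul_pow, pow_add, ← pow_mul, ← pow_mul, ← pow_mul, mul_comm (N - 1) N]
    ring
end

section
/- Let N ≥ 2 be a natural number with gcd(N, φ(N)) = 1, where φ is Euler's totient function. Then every unit c of the ring ZMod (N^2) can be written as c = (1+N)^m · s^N for some natural number m < N and some unit s of ZMod (N^2). That is, the ciphertext space of the Paillier-style scheme is exhausted by encryptions: the plaintext–randomness representation (m, s) covers all invertible residues modulo N². -/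
/-- Surjectivity of Paillier encryption onto the units of ZMod (N^2): every
unit c can be written as (1+N)^m · s^N with m < N and s a unit. -/
theorem paillier_enc_surjective (N : ℕ) (hN : 2 ≤ N)
    (hcop : Nat.gcd N (Nat.totient N) = 1) (c : (ZMod (N ^ 2))ˣ) :
    ∃ m : ℕ, m < N ∧ ∃ s : (ZMod (N ^ 2))ˣ,
      (c : ZMod (N ^ 2)) = (1 + (N : ZMod (N ^ 2))) ^ m * ((s : ZMod (N ^ 2))) ^ N := by
  have hNN : (N : ZMod (N ^ 2)) * N = 0 := by
    have h := ZMod.natCast_self (N ^ 2)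
    rw [Nat.cast_pow] at h
    rw [← h]; ring
  have hpow : ∀ k : ℕ, (1 + (N : ZMod (N ^ 2))) ^ k = 1 + k * N := by
    intro k
    induction k with
    | zero => simp
    | succ k ih =>
      rw [pow_succ (1 + (N : ZMod (N ^ 2))) k, ih]
      push_cast
      linear_combination (k : ZMod (N ^ 2)) * hNN
  have hgN : (1 + (N : ZMod (N ^ 2))) ^ N = 1 := by rw [hpow, hNN, add_zero]
  have : NeZero (N ^ 2) := ⟨by positivity⟩
  obtain ⟨k, hk⟩ : ∃ k : ℕ, (c : ZMod (N ^ 2)) ^ N.totient = (1 + (N : ZMod (N ^ 2))) ^ k := by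
    have hc : Nat.Coprime (c : ZMod (N ^ 2)).val N :=
      Nat.Coprime.coprime_dvd_right (dvd_pow_self N two_ne_zero) (ZMod.val_coe_unit_coprime c)
    have h1 : (c : ZMod (N ^ 2)).val ^ N.totient % N = 1 := by
      have h := Nat.ModEq.pow_totient hc
      rw [Nat.ModEq, Nat.mod_eq_of_lt (by omega : 1 < N)] at h
      exact h
    have h2 := Nat.div_add_mod ((c : ZMod (N ^ 2)).val ^ N.totient) N
    rw [h1] at h2
    refine ⟨(c : ZMod (N ^ 2)).val ^ N.totient / N, ?_⟩
    have h3 := congrArg (Nat.cast : ℕ → ZMod (N ^ 2)) h2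
    rw [Nat.cast_pow, ZMod.natCast_zmod_val] at h3
    rw [hpow, ← h3]
    push_cast
    ring
  obtain ⟨a, ha⟩ := Nat.exists_mul_mod_eq_one_of_coprime
    (Nat.Coprime.symm hcop : Nat.Coprime N.totient N) (by omega)
  have hb := Nat.div_add_mod (N.totient * a) N
  rw [ha.2] at hb
  set b := N.totient * a / N
  refine ⟨k * a % N, Nat.mod_lt _ (by omega), (c⁻¹) ^ b, ?_⟩
  have hred : (1 + (N : ZMod (N ^ 2))) ^ (k * a % N) = (1 + (N : ZMod (N ^ 2))) ^ (k * a) := by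
    conv_rhs => rw [← Nat.div_add_mod (k * a) N, pow_add, pow_mul, hgN, one_pow, one_mul]
  rw [hred, pow_mul, ← hk, ← pow_mul, ← hb]
  norm_cast
  rw [← pow_mul, inv_pow, mul_comm b N, pow_succ' c (N * b)]
  simp
end
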